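/- Let G act on sets X and Y, α : X → G and β : Y → G conjugation-equivariant maps, and define r : X × Y → G by r(x,y) = α(x) β(y)⁻¹, where G acts diagonally on X × Y. Then r is conjugation-equivariant for the diagonal action, and r̂ = (β̃)^{-1}-hat composed appropriately: explicitly, r̂(x,y) = (α(x)β(y)⁻¹·x, α(x)β(y)⁻¹·y) and r̂ = g_β⁻¹ ∘ (α̂ × β̂⁻¹) ∘ f_α, where f_α(x,y) = (x, α(x)·y) and g_β(x,y) = (β(y)·x, y). -/

import Mathlib

/-- r(x,y) = α(x)β(y)⁻¹ is conjugation-equivariant for the diagonal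
action on X × Y, r̂(x,y) = (α(x)β(y)⁻¹·x, α(x)β(y)⁻¹·y), and
r̂ = g_β⁻¹ ∘ (α̂ × β̂⁻¹) ∘ f_α, where f_α(x,y) = (x, α(x)·y) and
g_β(x,y) = (β(y)·x, y) (so g_β⁻¹(x,y) = (β(y)⁻¹·x, y)). -/
theorem r_hat_decomposition {G X Y : Type*} [Group G]
    [MulAction G X] [MulAction G Y]
    (α : X → G) (hα : ∀ (g : G) (x : X), α (g • x) = g * α x * g⁻¹)
    (β : Y → G) (hβ : ∀ (g : G) (y : Y), β (g • y) = g * β y * g⁻¹) :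
    (∀ (g : G) (x : X) (y : Y),
      α (g • x) * (β (g • y))⁻¹ = g * (α x * (β y)⁻¹) * g⁻¹) ∧
    (∀ (x : X) (y : Y),
      ((α x * (β y)⁻¹) • x, (α x * (β y)⁻¹) • y) =
        (let v : Y := (β (α x • y))⁻¹ • (α x • y);
          ((β v)⁻¹ • (α x • x), v))) := by
  refine ⟨fun g x y => ?_, fun x y => ?_⟩
  · rw [hα, hβ]
    group
  · have hv : (β (α x • y))⁻¹ • (α x • y) = (α x * (β y)⁻¹) • y := by
      rw [hβ, smul_smul]
      group
    simp only [hv]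
    rw [hβ, smul_smul]
    group
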